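/- arXiv:0911.2201 — 2 statements merged into one kernel-verified Lean document; each statement's English description precedes it below -/
import Mathlib

section
/- Let μ be a Borel probability measure on ℝ, A(s) = ∫_ℝ e^{−isλ} dμ(λ), and let E_Z ∈ ℝ. Then the following three statements are equivalent: (1) Λ·μ((−Λ,Λ)ᶜ) → 0 as Λ → +∞ and ∫_{(−Λ,Λ)} λ dμ(λ) → E_Z as Λ → +∞; (2) A is differentiable at 0 with A'(0) = −i·E_Z; (3) for every T > 0, sup_{|t|≤T} |A(t/N)^N − e^{−itE_Z}| → 0 as N → +∞. -/
open MeasureTheory Filter Topology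

lemma norm_pow_sub_pow_le_mul_norm_sub {a b : ℂ} (ha : ‖a‖ ≤ 1) (hb : ‖b‖ ≤ 1) (n : ℕ) :
    ‖a ^ n - b ^ n‖ ≤ n * ‖a - b‖ := by
  induction n with
  | zero => simp
  | succ n ih =>
    have h : a ^ (n + 1) - b ^ (n + 1) = a ^ n * (a - b) + (a ^ n - b ^ n) * b := by ring
    calc ‖a ^ (n + 1) - b ^ (n + 1)‖
        ≤ ‖a ^ n * (a - b)‖ + ‖(a ^ n - b ^ n) * b‖ := h ▸ norm_add_le _ _
      _ ≤ 1 * ‖a - b‖ + (n * ‖a - b‖) * 1 := by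
          rw [norm_mul, norm_mul, norm_pow]
          gcongr
          exact pow_le_one₀ (norm_nonneg _) ha
      _ = (n + 1 : ℕ) * ‖a - b‖ := by push_cast; ring

/-- If the powers `w ^ k`, `n ≤ k ≤ 2 * n`, are all close to `1`, then `w` is within `O(1 / n)`
of `1`. -/
lemma mul_norm_sub_one_le_of_pow_near_one {w : ℂ} {n : ℕ} {ε : ℝ} (hε : ε ≤ 1 / 8)
    (h : ∀ k, n ≤ k → k ≤ 2 * n → ‖w ^ k - 1‖ ≤ ε) :
    n * ‖w - 1‖ ≤ 2 * ε := by
  have hn := h n le_rfl (by omega)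
  have hwn : 1 / 2 ≤ ‖w ^ n‖ := by
    have := norm_sub_norm_le (1 : ℂ) (1 - w ^ n)
    rw [norm_sub_rev 1 (w ^ n)] at this
    simp only [norm_one, sub_sub_cancel] at this
    linarith
  have hj : ∀ j ∈ Finset.range n, ‖w ^ j - 1‖ ≤ 1 / 2 := by
    intro j hj
    have hj := Finset.mem_range.1 hj
    have h1 := h (n + j) (by omega) (by omega)
    have h2 : ‖w ^ n‖ * ‖w ^ j - 1‖ ≤ ε + ε := by
      rw [← norm_mul, show w ^ n * (w ^ j - 1) = (w ^ (n + j) - 1) - (w ^ n - 1) by ring]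
      exact (norm_sub_le _ _).trans (add_le_add h1 hn)
    nlinarith [norm_nonneg (w ^ j - 1)]
  have hsum : (n : ℝ) / 2 ≤ ‖∑ j ∈ Finset.range n, w ^ j‖ := by
    have h1 : ‖∑ j ∈ Finset.range n, (w ^ j - 1)‖ ≤ n * (1 / 2) := by
      simpa using norm_sum_le_of_le _ hj
    have h2 := norm_sub_norm_le (n : ℂ) (-∑ j ∈ Finset.range n, (w ^ j - 1))
    rw [norm_neg, Complex.norm_natCast, sub_neg_eq_add] at h2
    have h3 : (n : ℂ) + ∑ j ∈ Finset.range n, (w ^ j - 1) = ∑ j ∈ Finset.range n, w ^ j := by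
      simp
    rw [h3] at h2
    linarith
  have hgeom : ‖∑ j ∈ Finset.range n, w ^ j‖ * ‖w - 1‖ ≤ ε := by
    rw [← norm_mul, geom_sum_mul]
    exact hn
  nlinarith [norm_nonneg (w - 1)]

lemma norm_exp_neg_I_mul (x y : ℝ) : ‖Complex.exp (-(Complex.I * x * y))‖ = 1 := by
  simp [Complex.norm_exp]

lemma hasDerivAt_exp_neg_I_mul (y : ℝ) :
    HasDerivAt (fun x : ℝ => Complex.exp (-(Complex.I * x * y))) (-(Complex.I * y)) 0 := by
  have h : HasDerivAt (fun z : ℂ => Complex.exp (-(Complex.I * z * y)))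
      (-(Complex.I * y)) ((0 : ℝ) : ℂ) := by
    convert! (((hasDerivAt_id ((0 : ℝ) : ℂ)).const_mul Complex.I).mul_const (y : ℂ)).neg.cexp
      using 1
    simp
  exact h.comp_ofReal

lemma tendstoUniformlyOn_pow_of_hasDerivAt {A : ℝ → ℂ} (hA : ∀ s, ‖A s‖ ≤ 1) (hA0 : A 0 = 1)
    {y : ℝ} (h : HasDerivAt A (-(Complex.I * y)) 0) {T : ℝ} (hT : 0 < T) :
    TendstoUniformlyOn (fun (N : ℕ) (t : ℝ) => A (t / N) ^ N)
       (fun t : ℝ => Complex.exp (-(Complex.I * t * y))) atTop (Set.Icc (-T) T) := by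
  have h0 := h.sub (hasDerivAt_exp_neg_I_mul y)
  rw [sub_self, hasDerivAt_iff_isLittleO] at h0
  simp only [Pi.sub_apply, hA0, sub_zero, smul_zero] at h0
  simp only [Complex.ofReal_zero, mul_zero, zero_mul, neg_zero, Complex.exp_zero, sub_self,
    sub_zero] at h0
  rw [Metric.tendstoUniformlyOn_iff]
  intro ε hε
  obtain ⟨δ, hδ, hball⟩ := Metric.eventually_nhds_iff.1 (h0.def (c := ε / (2 * T)) (by positivity))
  have hlim : Tendsto (fun N : ℕ => T / (N : ℝ)) atTop (𝓝 0) :=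
    tendsto_const_div_atTop_nhds_zero_nat T
  filter_upwards [hlim.eventually_lt_const hδ, eventually_gt_atTop 0] with N hN hN0 t ht
  have hNr : (0 : ℝ) < N := by exact_mod_cast hN0
  have ht' : |t| ≤ T := abs_le.2 ht
  have hexp : Complex.exp (-(Complex.I * t * y))
      = Complex.exp (-(Complex.I * (t / N : ℝ) * y)) ^ N := by
    rw [← Complex.exp_nat_mul]
    congr 1
    have : (N : ℂ) ≠ 0 := by exact_mod_cast hN0.ne'
    push_cast
    field_simp
  have hb := @hball (t / N) (by
    rw [dist_zero_right, Real.norm_eq_abs, abs_div, abs_of_pos hNr]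
    exact lt_of_le_of_lt (by gcongr) hN)
  rw [hexp, dist_comm, dist_eq_norm]
  calc _ ≤ N * ‖A (t / N) - Complex.exp (-(Complex.I * (t / N : ℝ) * y))‖ :=
        norm_pow_sub_pow_le_mul_norm_sub (hA _) (norm_exp_neg_I_mul _ _).le N
    _ ≤ N * (ε / (2 * T) * ‖t / N‖) := by gcongr
    _ = ε / (2 * T) * |t| := by
        rw [Real.norm_eq_abs, abs_div, abs_of_pos hNr]
        field_simp
    _ ≤ ε / (2 * T) * T := by gcongr
    _ = ε / 2 := by field_simp
    _ < ε := by linarith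

lemma hasDerivAt_of_tendstoUniformlyOn_pow {A : ℝ → ℂ} (hA0 : A 0 = 1) {y : ℝ}
    (h : TendstoUniformlyOn (fun (N : ℕ) (t : ℝ) => A (t / N) ^ N)
       (fun t : ℝ => Complex.exp (-(Complex.I * t * y))) atTop (Set.Icc (-2) 2)) :
    HasDerivAt A (-(Complex.I * y)) 0 := by
  set e : ℝ → ℂ := fun t => Complex.exp (-(Complex.I * t * y)) with he
  have he0 : e 0 = 1 := by simp [he]
  have hne : ∀ t, e t ≠ 0 := fun t => Complex.exp_ne_zero _
  have hnorm : ∀ t, ‖e t‖ = 1 := fun t => norm_exp_neg_I_mul t y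
  have hB : HasDerivAt (fun s => A s / e s) 0 0 := by
    rw [hasDerivAt_iff_isLittleO]
    simp only [hA0, he0, sub_zero, smul_zero, div_one]
    rw [Asymptotics.isLittleO_iff]
    intro c hc
    rw [Metric.tendstoUniformlyOn_iff] at h
    set ε := min (1 / 8) (c / 4) with hε
    have hεpos : 0 < ε := by positivity
    obtain ⟨N₀, hN₀⟩ := eventually_atTop.1 (h ε hεpos)
    rw [Metric.eventually_nhds_iff]
    refine ⟨1 / (N₀ + 1), by positivity, fun s hs => ?_⟩
    rw [dist_zero_right, Real.norm_eq_abs] at hs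
    rcases eq_or_ne s 0 with rfl | hs0
    · simp [hA0, he0]
    have hspos : 0 < |s| := abs_pos.2 hs0
    set n := ⌊1 / |s|⌋₊ with hn
    have hinv : (N₀ : ℝ) + 1 ≤ 1 / |s| := by
      rw [le_div_iff₀ hspos]
      rw [lt_div_iff₀ (by positivity)] at hs
      linarith
    have hnN : N₀ + 1 ≤ n := Nat.le_floor (by exact_mod_cast hinv)
    have hn1 : (1 : ℝ) ≤ n := by exact_mod_cast (by omega : 1 ≤ n)
    have hnle : n * |s| ≤ 1 := by
      rw [← le_div_iff₀ hspos]
      exact Nat.floor_le (by positivity)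
    have hnlt : 1 ≤ (n + 1) * |s| := by
      rw [← div_le_iff₀ hspos]
      exact (Nat.lt_floor_add_one _).le
    have hpow : ∀ k, n ≤ k → k ≤ 2 * n → ‖(A s / e s) ^ k - 1‖ ≤ ε := by
      intro k hk1 hk2
      have hkpos : (0 : ℝ) < k := by exact_mod_cast (by omega : 0 < k)
      have hk2' : (k : ℝ) ≤ 2 * n := by exact_mod_cast hk2
      have hmem : (k : ℝ) * s ∈ Set.Icc (-2 : ℝ) 2 := by
        rw [Set.mem_Icc, ← abs_le, abs_mul, abs_of_pos hkpos]
        nlinarith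
      have h1 := hN₀ k (by omega) _ hmem
      rw [mul_div_cancel_left₀ _ hkpos.ne'] at h1
      have hek : e (k * s) = e s ^ k := by
        simp only [he]
        rw [← Complex.exp_nat_mul]
        congr 1
        push_cast
        ring
      rw [hek, dist_comm, dist_eq_norm] at h1
      have h2 : (A s / e s) ^ k - 1 = (A s ^ k - e s ^ k) / e s ^ k := by
        rw [div_pow, sub_div, div_self (pow_ne_zero _ (hne s))]
      rw [h2, norm_div, norm_pow (e s), hnorm, one_pow, div_one]
      exact h1.le
    have hkey := mul_norm_sub_one_le_of_pow_near_one (min_le_left _ _) hpow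
    have hεc : ε ≤ c / 4 := min_le_right _ _
    rw [Real.norm_eq_abs]
    nlinarith [norm_nonneg (A s / e s - 1)]
  have hmul : HasDerivAt (fun s => A s / e s * e s) (0 * e 0 + A 0 / e 0 * -(Complex.I * y)) 0 :=
    hB.mul (hasDerivAt_exp_neg_I_mul y)
  simpa [hA0, he0, hne] using hmul

section
variable {μ : Measure ℝ} [IsProbabilityMeasure μ]

lemma integrableOn_Ioo_of_continuous {E : Type*} [NormedAddCommGroup E] {ν : Measure ℝ}
    [IsFiniteMeasure ν] {f : ℝ → E} (hf : Continuous f) (a b : ℝ) :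
    IntegrableOn f (Set.Ioo a b) ν :=
  (hf.integrableOn_Icc).mono_set Set.Ioo_subset_Icc_self

lemma setIntegral_sq_le_sq (r : ℝ) :
    ∫ l in Set.Ioo (-r) r, l ^ 2 ∂μ ≤ r ^ 2 := by
  have h : ‖∫ l in Set.Ioo (-r) r, l ^ 2 ∂μ‖ ≤ r ^ 2 * μ.real (Set.Ioo (-r) r) := by
    refine norm_setIntegral_le_of_norm_le_const (measure_lt_top _ _) fun l hl => ?_
    rw [Real.norm_eq_abs, abs_pow]
    have := (abs_lt.2 hl).le
    gcongr
  have h1 : μ.real (Set.Ioo (-r) r) ≤ 1 := measureReal_le_one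
  nlinarith [Real.le_norm_self (∫ l in Set.Ioo (-r) r, l ^ 2 ∂μ), sq_nonneg r]

lemma setIntegral_sq_le_half_add {r : ℝ} (hr : 0 ≤ r) :
    ∫ l in Set.Ioo (-r) r, l ^ 2 ∂μ ≤ ∫ l in Set.Ioo (-(r / 2)) (r / 2), l ^ 2 ∂μ +
      r ^ 2 * μ.real (Set.Ioo (-(r / 2)) (r / 2))ᶜ := by
  have hsub : Set.Ioo (-(r / 2)) (r / 2) ⊆ Set.Ioo (-r) r :=
    Set.Ioo_subset_Ioo (by linarith) (by linarith)
  have hint := integrableOn_Ioo_of_continuous (ν := μ) (continuous_pow 2) (-r) r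
  have hd := setIntegral_sdiff (f := fun l : ℝ => l ^ 2) measurableSet_Ioo hint hsub
  have h : ‖∫ l in Set.Ioo (-r) r \ Set.Ioo (-(r / 2)) (r / 2), l ^ 2 ∂μ‖ ≤
      r ^ 2 * μ.real (Set.Ioo (-r) r \ Set.Ioo (-(r / 2)) (r / 2)) := by
    refine norm_setIntegral_le_of_norm_le_const (measure_lt_top _ _) fun l hl => ?_
    rw [Real.norm_eq_abs, abs_pow]
    have := (abs_lt.2 hl.1).le
    gcongr
  have hm : μ.real (Set.Ioo (-r) r \ Set.Ioo (-(r / 2)) (r / 2)) ≤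
      μ.real (Set.Ioo (-(r / 2)) (r / 2))ᶜ := measureReal_mono fun x hx => hx.2
  rw [hd] at h
  nlinarith [Real.le_norm_self (∫ l in Set.Ioo (-r) r, l ^ 2 ∂μ -
    ∫ l in Set.Ioo (-(r / 2)) (r / 2), l ^ 2 ∂μ), sq_nonneg r]

lemma tendsto_inv_mul_setIntegral_sq
    (h : Tendsto (fun r : ℝ => r * μ.real (Set.Ioo (-r) r)ᶜ) atTop (𝓝 0)) :
    Tendsto (fun r : ℝ => r⁻¹ * ∫ l in Set.Ioo (-r) r, l ^ 2 ∂μ) atTop (𝓝 0) := by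
  have hnonneg : ∀ r : ℝ, 0 ≤ ∫ l in Set.Ioo (-r) r, l ^ 2 ∂μ :=
    fun r => integral_nonneg fun l => sq_nonneg l
  have key : ∀ ε > 0, ∃ C, ∀ r > 0, ∫ l in Set.Ioo (-r) r, l ^ 2 ∂μ ≤ C + 4 * ε * r := by
    intro ε hε
    obtain ⟨M, hM'⟩ := eventually_atTop.1
      ((h.eventually_lt_const hε).and (eventually_ge_atTop 1))
    have hM1 : 1 ≤ M := (hM' M le_rfl).2
    have hM : ∀ r ≥ M, r * μ.real (Set.Ioo (-r) r)ᶜ < ε := fun r hr => (hM' r hr).1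
    have hind : ∀ n : ℕ, ∀ r > 0, r ≤ 2 ^ n * (2 * M) →
        ∫ l in Set.Ioo (-r) r, l ^ 2 ∂μ ≤ 4 * M ^ 2 + 4 * ε * r := by
      intro n
      induction n with
      | zero =>
        intro r hr hrM
        have := setIntegral_sq_le_sq (μ := μ) r
        have : 0 < ε * r := by positivity
        nlinarith
      | succ n ih =>
        intro r hr hrM
        rcases le_total r (2 * M) with hle | hle
        · have := setIntegral_sq_le_sq (μ := μ) r
          have : 0 < ε * r := by positivity
          nlinarith
        have h1 := ih (r / 2) (by positivity) (by rw [pow_succ] at hrM; linarith)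
        have h2 := setIntegral_sq_le_half_add (μ := μ) hr.le
        have h3 := hM (r / 2) (by linarith)
        nlinarith
    refine ⟨4 * M ^ 2, fun r hr => ?_⟩
    obtain ⟨n, hn⟩ := pow_unbounded_of_one_lt r one_lt_two
    refine hind n r hr (hn.le.trans ?_)
    have : (0 : ℝ) < 2 ^ n := by positivity
    nlinarith
  rw [Metric.tendsto_nhds]
  intro ε hε
  obtain ⟨C, hC⟩ := key (ε / 8) (by positivity)
  have hlim : Tendsto (fun r : ℝ => r⁻¹ * C) atTop (𝓝 0) := by
    simpa using tendsto_inv_atTop_zero.mul_const C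
  filter_upwards [hlim.eventually_lt_const (half_pos hε), eventually_gt_atTop 0] with r hr hr0
  rw [dist_zero_right, Real.norm_of_nonneg (mul_nonneg (by positivity) (hnonneg r))]
  calc r⁻¹ * ∫ l in Set.Ioo (-r) r, l ^ 2 ∂μ ≤ r⁻¹ * (C + 4 * (ε / 8) * r) := by
        gcongr; exact hC r hr0
    _ = r⁻¹ * C + ε / 2 := by field_simp; ring
    _ < ε := by linarith

/-- Truncating at height `r ≤ 1 / |s|` the first order expansion of the characteristic function. -/
lemma norm_charFun_sub_le {s r : ℝ} (hr : |s| * r ≤ 1) :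
    ‖charFun μ s - 1 - s * Complex.I * (∫ l in Set.Ioo (-r) r, l ∂μ : ℝ)‖ ≤
      2 * μ.real (Set.Ioo (-r) r)ᶜ + s ^ 2 * ∫ l in Set.Ioo (-r) r, l ^ 2 ∂μ := by
  have hce : Integrable (fun l : ℝ => Complex.exp (s * l * Complex.I)) μ := by
    refine Integrable.of_bound (by fun_prop) 1 (.of_forall fun l => ?_)
    rw [← Complex.ofReal_mul, Complex.norm_exp_ofReal_mul_I]
  have hci : Integrable (fun l : ℝ => Complex.exp (s * l * Complex.I) - 1) μ :=
    hce.sub (integrable_const _)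
  have h1 : charFun μ s - 1 = ∫ l : ℝ, (Complex.exp (s * l * Complex.I) - 1) ∂μ := by
    rw [integral_sub hce (integrable_const _), charFun_apply_real]
    simp
  have h2 : s * Complex.I * (∫ l in Set.Ioo (-r) r, l ∂μ : ℝ) =
      ∫ l : ℝ in Set.Ioo (-r) r, (s * l * Complex.I : ℂ) ∂μ := by
    rw [← integral_complex_ofReal, ← integral_const_mul]
    congr with l
    ring
  rw [h1, h2, ← integral_add_compl (measurableSet_Ioo (a := -r) (b := r)) hci, add_sub_right_comm,
    ← integral_sub hci.integrableOn (integrableOn_Ioo_of_continuous (by fun_prop) _ _), add_comm]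
  refine (norm_add_le _ _).trans (add_le_add ?_ ?_)
  · refine norm_setIntegral_le_of_norm_le_const (measure_lt_top _ _) fun l _ => ?_
    refine (norm_sub_le _ _).trans ?_
    rw [← Complex.ofReal_mul, Complex.norm_exp_ofReal_mul_I]
    norm_num
  · rw [← integral_const_mul]
    refine norm_integral_le_of_norm_le
      (integrableOn_Ioo_of_continuous (by fun_prop) _ _) ?_
    refine (ae_restrict_iff' measurableSet_Ioo).2 (.of_forall fun l hl => ?_)
    have hn : ‖(s * l * Complex.I : ℂ)‖ = |s| * |l| := by simp
    have hl' := (abs_lt.2 hl).le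
    refine (Complex.norm_exp_sub_one_sub_id_le ?_).trans_eq ?_
    · rw [hn]
      exact (by gcongr : |s| * |l| ≤ |s| * r).trans hr
    · rw [hn, mul_pow, sq_abs, sq_abs]

lemma tendsto_abs_inv_nhdsNE_zero : Tendsto (fun s : ℝ => |s|⁻¹) (𝓝[≠] 0) atTop :=
  tendsto_inv_nhdsGT_zero.comp (tendsto_norm_nhdsNE_zero (E := ℝ))

lemma tendsto_slope_charFun_sub
    (h : Tendsto (fun r : ℝ => r * μ.real (Set.Ioo (-r) r)ᶜ) atTop (𝓝 0)) :
    Tendsto (fun s : ℝ => slope (charFun μ) 0 s -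
      Complex.I * (∫ l in Set.Ioo (-|s|⁻¹) |s|⁻¹, l ∂μ : ℝ)) (𝓝[≠] 0) (𝓝 0) := by
  have hlim := ((h.const_mul 2).add (tendsto_inv_mul_setIntegral_sq h)).comp
    tendsto_abs_inv_nhdsNE_zero
  rw [mul_zero, add_zero] at hlim
  refine squeeze_zero_norm' ?_ hlim
  filter_upwards [self_mem_nhdsWithin] with s hs
  have hs0 : s ≠ 0 := hs
  have hspos : 0 < |s| := abs_pos.2 hs0
  have hb := norm_charFun_sub_le (μ := μ) (s := s) (r := |s|⁻¹) (by field_simp; rfl)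
  have heq : slope (charFun μ) 0 s - Complex.I * (∫ l in Set.Ioo (-|s|⁻¹) |s|⁻¹, l ∂μ : ℝ) =
      (s : ℂ)⁻¹ * (charFun μ s - 1 -
        s * Complex.I * (∫ l in Set.Ioo (-|s|⁻¹) |s|⁻¹, l ∂μ : ℝ)) := by
    have : (s : ℂ) ≠ 0 := by exact_mod_cast hs0
    simp only [slope, vsub_eq_sub, sub_zero, charFun_zero, probReal_univ, Complex.ofReal_one,
      Complex.real_smul, Complex.ofReal_inv]
    field_simp
  rw [heq, norm_mul, norm_inv, Complex.norm_real, Real.norm_eq_abs]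
  refine (mul_le_mul_of_nonneg_left hb (by positivity)).trans_eq ?_
  simp only [Function.comp_apply, inv_inv]
  rw [← sq_abs s]
  field_simp

lemma tendsto_mul_measureReal_compl_Ioo_of_hasDerivAt {y : ℝ}
    (h : HasDerivAt (charFun μ) (Complex.I * y) 0) :
    Tendsto (fun r : ℝ => r * μ.real (Set.Ioo (-r) r)ᶜ) atTop (𝓝 0) := by
  rw [hasDerivAt_iff_isLittleO] at h
  simp only [charFun_zero, probReal_univ, Complex.ofReal_one, sub_zero, Complex.real_smul] at h
  rw [Metric.tendsto_nhds]
  intro ε hε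
  obtain ⟨δ, hδ, hball⟩ := Metric.eventually_nhds_iff.1 (h.def (c := ε / 64) (by positivity))
  filter_upwards [eventually_gt_atTop 0, eventually_gt_atTop (4 / δ)] with r hr hrδ
  rw [dist_zero_right, Real.norm_of_nonneg (by positivity)]
  set a : ℝ := 2 * (r / 2)⁻¹ with ha
  have ha4 : a = 4 / r := by rw [ha]; field_simp; norm_num
  have hapos : 0 < a := by positivity
  have haδ : a < δ := by
    rw [ha4, div_lt_iff₀ hr]
    rw [div_lt_iff₀ hδ] at hrδ
    linarith
  have hsub : μ.real (Set.Ioo (-r) r)ᶜ ≤ μ.real {x | r / 2 < |x|} := by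
    refine measureReal_mono fun x hx => ?_
    have : ¬ |x| < r := fun hlt => hx (abs_lt.1 hlt)
    simp only [Set.mem_ofPred_eq]
    linarith
  have hmain := measureReal_abs_gt_le_integral_charFun (μ := μ) (half_pos hr)
  have hodd : ∫ t in (-a)..a, (t * (Complex.I * y) : ℂ) = 0 := by
    have hid : ∫ t in (-a)..a, (t : ℂ) = 0 := by
      rw [intervalIntegral.integral_ofReal, integral_id]
      simp
    rw [intervalIntegral.integral_mul_const, hid, zero_mul]
  have hint : ∫ t in (-a)..a, (1 - charFun μ t) =
      -∫ t in (-a)..a, (charFun μ t - 1 - t * (Complex.I * y)) := by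
    have hc : Continuous (charFun μ) := continuous_charFun
    rw [intervalIntegral.integral_sub (f := fun t => charFun μ t - 1)
      (Continuous.intervalIntegrable (by fun_prop) _ _)
      (Continuous.intervalIntegrable (by fun_prop) _ _), hodd, sub_zero,
      ← intervalIntegral.integral_neg]
    simp only [neg_sub]
  have hbound : ‖∫ t in (-a)..a, (charFun μ t - 1 - t * (Complex.I * y))‖ ≤
      ε / 64 * a * |a - -a| := by
    refine intervalIntegral.norm_integral_le_of_norm_le_const fun t ht => ?_
    rw [Set.uIoc_of_le (by linarith)] at ht
    have hta : |t| ≤ a := abs_le.2 ⟨ht.1.le, ht.2⟩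
    refine (@hball t (by rw [dist_zero_right]; exact lt_of_le_of_lt hta haδ)).trans ?_
    rw [Real.norm_eq_abs]
    gcongr
  rw [neg_mul, ← ha, hint, norm_neg] at hmain
  rw [sub_neg_eq_add, abs_of_pos (by linarith)] at hbound
  calc r * μ.real (Set.Ioo (-r) r)ᶜ ≤ r * (2⁻¹ * (r / 2) * (ε / 64 * a * (a + a))) := by
        gcongr
        exact hsub.trans (hmain.trans (by gcongr))
    _ = ε / 8 := by rw [ha4]; field_simp; norm_num
    _ < ε := by linarith

lemma hasDerivAt_charFun_iff_tendsto_setIntegral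
    (h : Tendsto (fun r : ℝ => r * μ.real (Set.Ioo (-r) r)ᶜ) atTop (𝓝 0)) {y : ℝ} :
    HasDerivAt (charFun μ) (Complex.I * y) 0 ↔
      Tendsto (fun r : ℝ => ∫ l in Set.Ioo (-r) r, l ∂μ) atTop (𝓝 y) := by
  have hslope := tendsto_slope_charFun_sub h
  rw [hasDerivAt_iff_tendsto_slope]
  constructor
  · intro hd
    have hinv : Tendsto (fun r : ℝ => r⁻¹) atTop (𝓝[≠] 0) :=
      tendsto_inv_atTop_nhdsGT_zero.mono_right (nhdsWithin_mono _ fun _ hx => ne_of_gt hx)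
    have hlim := (Complex.continuous_im.tendsto _).comp ((hd.sub hslope).comp hinv)
    rw [sub_zero, Complex.I_mul_im, Complex.ofReal_re] at hlim
    refine hlim.congr' ?_
    filter_upwards [eventually_gt_atTop 0] with r hr
    simp [abs_of_pos hr]
  · intro hm
    have hlim := hslope.add (((Complex.continuous_ofReal.tendsto y).comp
      (hm.comp tendsto_abs_inv_nhdsNE_zero)).const_mul Complex.I)
    simpa using hlim

end

theorem stmt_10 (μ : Measure ℝ) [IsProbabilityMeasure μ]
    (A : ℝ → ℂ) (hA : ∀ s : ℝ, A s = ∫ l : ℝ, Complex.exp (-(Complex.I * s * l)) ∂μ)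
    (E_Z : ℝ) :
    [Tendsto (fun Λ : ℝ => Λ * (μ (Set.Ioo (-Λ) Λ)ᶜ).toReal) atTop (𝓝 0) ∧
       Tendsto (fun Λ : ℝ => ∫ l in Set.Ioo (-Λ) Λ, l ∂μ) atTop (𝓝 E_Z),
     HasDerivAt A (-(Complex.I * E_Z)) 0,
     ∀ T > (0 : ℝ), TendstoUniformlyOn (fun (N : ℕ) (t : ℝ) => A (t / N) ^ N)
       (fun t : ℝ => Complex.exp (-(Complex.I * t * E_Z))) atTop (Set.Icc (-T) T)].TFAE := by
  have hcf : ∀ s, A s = charFun μ (-s) := by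
    intro s
    rw [hA, charFun_apply_real]
    congr with l
    congr 1
    push_cast
    ring
  have hA1 : ∀ s, ‖A s‖ ≤ 1 := fun s => hcf s ▸ norm_charFun_le_one _
  have hA0 : A 0 = 1 := by simp [hcf]
  have hderiv : HasDerivAt A (-(Complex.I * E_Z)) 0 ↔
      HasDerivAt (charFun μ) (Complex.I * E_Z) 0 := by
    have hneg : A = fun s => charFun μ (-s) := funext hcf
    have hneg' : charFun μ = fun s => A (-s) := funext fun s => by rw [hcf, neg_neg]
    constructor
    · intro h
      rw [hneg']
      have := HasDerivAt.scomp (0 : ℝ) (g₁ := A) (by simpa using h) (hasDerivAt_neg (0 : ℝ))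
      simpa [Function.comp_def] using this
    · intro h
      rw [hneg]
      have := HasDerivAt.scomp (0 : ℝ) (g₁ := charFun μ) (by simpa using h)
        (hasDerivAt_neg (0 : ℝ))
      simpa [Function.comp_def] using this
  tfae_have 1 → 2 := fun h =>
    hderiv.2 ((hasDerivAt_charFun_iff_tendsto_setIntegral h.1).2 h.2)
  tfae_have 2 → 1 := fun h =>
    have htail := tendsto_mul_measureReal_compl_Ioo_of_hasDerivAt (hderiv.1 h)
    ⟨htail, (hasDerivAt_charFun_iff_tendsto_setIntegral htail).1 (hderiv.1 h)⟩
  tfae_have 2 → 3 := fun h T hT => tendstoUniformlyOn_pow_of_hasDerivAt hA1 hA0 h hT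
  tfae_have 3 → 2 := fun h => hasDerivAt_of_tendstoUniformlyOn_pow hA0 (h 2 two_pos)
  tfae_finish
end

section
/- Let μ be a Borel probability measure on ℝ supported on [0,+∞) (i.e. μ((−∞,0)) = 0), and let A(s) = ∫_ℝ e^{−isλ} dμ(λ). Then λ ↦ λ is μ-integrable if and only if there exists E ∈ ℝ such that for every T > 0, sup_{|t|≤T} |A(t/N)^N − e^{−itE}| → 0 as N → +∞; moreover, in that case E = ∫_ℝ λ dμ(λ). -/
open MeasureTheory Filter Topology

theorem norm_pow_sub_pow_le_mul {z w : ℂ} (hz : ‖z‖ ≤ 1) (hw : ‖w‖ ≤ 1) (n : ℕ) :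
    ‖z ^ n - w ^ n‖ ≤ n * ‖z - w‖ := by
  induction n with
  | zero => simp
  | succ n ih =>
    have hsplit : z ^ (n + 1) - w ^ (n + 1) = z * (z ^ n - w ^ n) + (z - w) * w ^ n := by ring
    calc ‖z ^ (n + 1) - w ^ (n + 1)‖
        ≤ ‖z‖ * ‖z ^ n - w ^ n‖ + ‖z - w‖ * ‖w‖ ^ n := by
          rw [hsplit]
          refine (norm_add_le _ _).trans_eq ?_
          rw [norm_mul, norm_mul, norm_pow]
      _ ≤ 1 * (n * ‖z - w‖) + ‖z - w‖ * 1 := by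
          gcongr
          exact pow_le_one₀ (norm_nonneg _) hw
      _ = (n + 1 : ℕ) * ‖z - w‖ := by push_cast; ring

/-- If two functions with values in the closed unit disc agree to first order at `0`, the
difference of their rescaled powers tends to `0` uniformly on compact intervals. -/
theorem tendstoUniformlyOn_rescaled_pow {f g : ℝ → ℂ} (hf : ∀ s, ‖f s‖ ≤ 1)
    (hg : ∀ s, ‖g s‖ ≤ 1) (hfg : (fun s => f s - g s) =o[𝓝 0] fun s : ℝ => s)
    {G : ℝ → ℂ} (hG : ∀ (N : ℕ) (t : ℝ), N ≠ 0 → g (t / N) ^ N = G t) {T : ℝ} (hT : 0 < T) :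
    TendstoUniformlyOn (fun (N : ℕ) (t : ℝ) => f (t / N) ^ N) G atTop (Set.Icc (-T) T) := by
  rw [Metric.tendstoUniformlyOn_iff]
  intro ε hε
  obtain ⟨δ, hδ, hbound⟩ := Metric.eventually_nhds_iff.1
    (hfg.def (show 0 < ε / (2 * T) by positivity))
  have hsmall : Tendsto (fun N : ℕ => T / (N : ℝ)) atTop (𝓝 0) :=
    tendsto_const_div_atTop_nhds_zero_nat T
  filter_upwards [hsmall.eventually_lt_const hδ, eventually_ne_atTop 0] with N hN hN0 t ht
  have hNpos : (0 : ℝ) < N := by positivity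
  have ht' : |t| ≤ T := abs_le.2 ht
  have habs : |t / N| ≤ T / N := by
    rw [abs_div, Nat.abs_cast]
    gcongr
  have hfirst := hbound (y := t / N) (by
    rw [Real.dist_eq, sub_zero]
    exact habs.trans_lt hN)
  rw [dist_comm, dist_eq_norm, ← hG N t hN0]
  calc _ ≤ N * ‖f (t / N) - g (t / N)‖ := norm_pow_sub_pow_le_mul (hf _) (hg _) N
    _ ≤ N * (ε / (2 * T) * (T / N)) := by
        gcongr
        refine hfirst.trans ?_
        rw [Real.norm_eq_abs]
        gcongr
    _ = ε / 2 := by field_simp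
    _ < ε := half_lt_self hε

/-- A continuous path whose exponential stays in the open right half-plane and which starts at `0`
never leaves the strip where the principal logarithm inverts the exponential. -/
theorem Complex.log_exp_of_continuousOn {h : ℝ → ℂ} {T : ℝ} (hcont : ContinuousOn h (Set.Icc 0 T))
    (h0 : h 0 = 0) (hre : ∀ t ∈ Set.Icc 0 T, 0 < (Complex.exp (h t)).re) {t : ℝ}
    (ht : t ∈ Set.Icc 0 T) : Complex.log (Complex.exp (h t)) = h t := by
  have him : ContinuousOn (fun t => (h t).im) (Set.Icc 0 t) :=
    Complex.continuous_im.comp_continuousOn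
      (hcont.mono (Set.Icc_subset_Icc_right ht.2))
  have hcos : ∀ u ∈ Set.Icc 0 t, Real.cos (h u).im ≠ -1 := by
    intro u hu hc
    have := hre u ⟨hu.1, hu.2.trans ht.2⟩
    rw [Complex.exp_re, hc] at this
    linarith [Real.exp_pos (h u).re]
  apply Complex.log_exp
  · by_contra! hle
    obtain ⟨u, hu, hu'⟩ := intermediate_value_Icc' ht.1 him
      (show -Real.pi ∈ Set.Icc (h t).im (h 0).im from ⟨hle, by simp [h0, Real.pi_pos.le]⟩)
    exact hcos u hu (by simp only at hu'; rw [hu']; simp)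
  · by_contra! hlt
    obtain ⟨u, hu, hu'⟩ := intermediate_value_Icc ht.1 him
      (show Real.pi ∈ Set.Icc (h 0).im (h t).im from ⟨by simp [h0, Real.pi_pos.le], hlt.le⟩)
    exact hcos u hu (by simp only at hu'; rw [hu']; simp)

/-- If the rescaled powers of a continuous function stay uniformly close to `1`, the function is
`1` up to a linear error on the right of `0`. -/
theorem exists_norm_sub_one_le_mul {w : ℝ → ℂ} (hw : Continuous w) (hw0 : w 0 = 1)
    (hpow : ∀ᶠ N : ℕ in atTop, ∀ t ∈ Set.Icc (0 : ℝ) 1, ‖w (t / N) ^ N - 1‖ ≤ 1 / 2) :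
    ∃ δ > 0, ∀ s ∈ Set.Ioc 0 δ, ‖w s - 1‖ ≤ 3 * s := by
  obtain ⟨η, hη, hnear⟩ := Metric.continuous_iff.1 hw 0 1 one_pos
  obtain ⟨N₁, hN₁⟩ := eventually_atTop.1
    (hpow.and ((tendsto_const_div_atTop_nhds_zero_nat (1 : ℝ)).eventually_lt_const hη))
  have key : ∀ N : ℕ, N₁ ≤ N → N ≠ 0 → ∀ t ∈ Set.Icc (0 : ℝ) 1,
      ‖w (t / N) - 1‖ ≤ 3 / 2 / N := by
    intro N hN hN0 t ht
    obtain ⟨hclose, hNη⟩ := hN₁ N hN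
    have hNpos : (0 : ℝ) < N := by positivity
    have hN1 : (1 : ℝ) ≤ N := by exact_mod_cast Nat.one_le_iff_ne_zero.2 hN0
    have hball : ∀ u ∈ Set.Icc (0 : ℝ) 1, ‖w (u / N) - 1‖ < 1 := by
      intro u hu
      have hu' : u / N ≤ 1 / N := by gcongr; exact hu.2
      have hnonneg : 0 ≤ u / N := div_nonneg hu.1 hNpos.le
      have := hnear (u / N) (by
        rw [Real.dist_eq, sub_zero, abs_of_nonneg hnonneg]
        exact hu'.trans_lt hNη)
      rwa [hw0, dist_eq_norm] at this
    have hslit : ∀ u ∈ Set.Icc (0 : ℝ) 1, w (u / N) ∈ Complex.slitPlane := fun u hu =>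
      Complex.ball_one_subset_slitPlane (by simpa [dist_eq_norm] using hball u hu)
    have hexp : ∀ u ∈ Set.Icc (0 : ℝ) 1,
        Complex.exp (N * Complex.log (w (u / N))) = w (u / N) ^ N := fun u hu => by
      rw [Complex.exp_nat_mul, Complex.exp_log (Complex.slitPlane_ne_zero (hslit u hu))]
    have hlog : Complex.log (w (t / N) ^ N) = N * Complex.log (w (t / N)) := by
      rw [← hexp t ht]
      refine Complex.log_exp_of_continuousOn (T := 1)
        (h := fun u : ℝ => N * Complex.log (w (u / N))) ?_ (by simp [hw0]) ?_ ht
      · refine continuousOn_const.mul (ContinuousOn.clog ?_ hslit)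
        exact (hw.comp (continuous_id.div_const _)).continuousOn
      · intro u hu
        rw [hexp u hu]
        have hre := (Complex.abs_re_le_norm _).trans (hclose u hu)
        rw [Complex.sub_re, Complex.one_re] at hre
        linarith [(abs_le.1 hre).1]
    have hnorm : N * ‖Complex.log (w (t / N))‖ ≤ 3 / 4 := by
      have hhalf := Complex.norm_log_one_add_half_le_self (hclose t ht)
      rw [add_sub_cancel, hlog, norm_mul, Complex.norm_natCast] at hhalf
      linarith [hclose t ht]
    have hle : ‖Complex.log (w (t / N))‖ ≤ 3 / 4 / N := by
      rw [le_div_iff₀ hNpos]; linarith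
    have hle1 : ‖Complex.log (w (t / N))‖ ≤ 1 := by
      nlinarith [norm_nonneg (Complex.log (w (t / N)))]
    have hfinal := Complex.norm_exp_sub_one_le hle1
    rw [Complex.exp_log (Complex.slitPlane_ne_zero (hslit t ht))] at hfinal
    calc _ ≤ 2 * ‖Complex.log (w (t / N))‖ := hfinal
      _ ≤ 2 * (3 / 4 / N) := by gcongr
      _ = 3 / 2 / N := by ring
  refine ⟨1 / (N₁ + 1), by positivity, fun s hs => ?_⟩
  have hs0 : 0 < s := hs.1
  have hinv : (N₁ : ℝ) + 1 ≤ 1 / s := (le_div_comm₀ (by positivity) hs0).2 hs.2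
  set N := ⌊1 / s⌋₊ with hNdef
  have hNN₁ : N₁ + 1 ≤ N := Nat.le_floor (by exact_mod_cast hinv)
  have hN0 : N ≠ 0 := by omega
  have hNpos : (0 : ℝ) < N := by positivity
  have hN1 : (1 : ℝ) ≤ N := by exact_mod_cast Nat.one_le_iff_ne_zero.2 hN0
  have hupper : s * N ≤ 1 := by
    have := Nat.floor_le (show 0 ≤ 1 / s by positivity)
    rw [← hNdef, le_div_iff₀ hs0] at this
    linarith
  have hlower : 1 ≤ s * (2 * N) := by
    have := Nat.lt_floor_add_one (1 / s)
    rw [← hNdef, div_lt_iff₀ hs0] at this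
    nlinarith
  have hk := key N (by omega) hN0 (s * N) ⟨by positivity, hupper⟩
  rw [mul_div_cancel_right₀ _ hNpos.ne'] at hk
  refine hk.trans ?_
  rw [div_le_iff₀ hNpos]
  linarith

/-- A nonnegative random variable whose sine transform grows at most linearly on the right of `0`
has finite mean. -/
theorem integrable_id_of_integral_sin_le {μ : Measure ℝ} [IsProbabilityMeasure μ]
    (hsupp : ∀ᵐ x ∂μ, 0 ≤ x) {C δ : ℝ} (hδ : 0 < δ)
    (hsin : ∀ s ∈ Set.Ioc 0 δ, ∫ x, Real.sin (s * x) ∂μ ≤ C * s) :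
    Integrable (fun x : ℝ => x) μ := by
  have hinner : ∀ h x : ℝ, ∫ u in (0 : ℝ)..h, Real.sin (u * x) = (1 - Real.cos (h * x)) / x := by
    intro h x
    rcases eq_or_ne x 0 with rfl | hx
    · simp
    · rw [intervalIntegral.integral_comp_mul_right (fun y => Real.sin y) hx, integral_sin]
      simp [div_eq_inv_mul]
  have hprod : ∀ h : ℝ, 0 ≤ h → Integrable (Function.uncurry fun u x : ℝ => Real.sin (u * x))
      ((volume.restrict (Set.uIoc 0 h)).prod μ) := by
    intro h hh
    rw [Set.uIoc_of_le hh]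
    refine Integrable.of_bound (C := 1) (Continuous.aestronglyMeasurable ?_) ?_
    · unfold Function.uncurry; fun_prop
    · exact ae_of_all _ fun p => Real.abs_sin_le_one _
  have hint : ∀ h : ℝ, 0 ≤ h → Integrable (fun x => (1 - Real.cos (h * x)) / x) μ := by
    intro h hh
    refine (hprod h hh).integral_prod_right.congr (ae_of_all _ fun x => ?_)
    simp only [← hinner, intervalIntegral.integral_of_le hh, Set.uIoc_of_le hh, Function.uncurry]
  have hbound : ∀ h ∈ Set.Ioc 0 δ, ∫ x, (1 - Real.cos (h * x)) / x ∂μ ≤ C * (h ^ 2 / 2) := by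
    intro h hh
    simp_rw [← hinner]
    rw [← intervalIntegral_integral_swap (hprod h hh.1.le)]
    have hcalc : ∫ u in (0 : ℝ)..h, C * u = C * (h ^ 2 / 2) := by
      rw [intervalIntegral.integral_const_mul, integral_id]; ring
    rw [← hcalc]
    refine intervalIntegral.integral_mono_on_of_le_Ioo hh.1.le ?_
      (Continuous.intervalIntegrable (by fun_prop) _ _)
      fun u hu => hsin u ⟨hu.1, hu.2.le.trans hh.2⟩
    rw [intervalIntegrable_iff]
    exact (hprod h hh.1.le).integral_prod_left
  have hcover := aecover_Iic (μ := μ) (tendsto_natCast_atTop_atTop (R := ℝ))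
  refine hcover.integrable_of_integral_bounded_of_nonneg_ae
    (Real.pi ^ 2 / 4 * C) (fun n => ?_) hsupp ?_
  · refine Integrable.of_bound (C := n) measurable_id.aestronglyMeasurable ?_
    rw [ae_restrict_iff' measurableSet_Iic]
    filter_upwards [hsupp] with x hx hxn
    rwa [Real.norm_of_nonneg hx]
  · filter_upwards [(tendsto_const_div_atTop_nhds_zero_nat (1 : ℝ)).eventually_le_const hδ,
      eventually_ne_atTop 0] with n hn hn0
    have hnpos : (0 : ℝ) < n := by positivity
    have hh : (1 : ℝ) / n ∈ Set.Ioc 0 δ := ⟨by positivity, hn⟩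
    have hG := (hint (1 / n) hh.1.le).const_mul (Real.pi ^ 2 / 2 * n ^ 2)
    have hGnonneg : ∀ᵐ x ∂μ,
        0 ≤ Real.pi ^ 2 / 2 * n ^ 2 * ((1 - Real.cos (1 / n * x)) / x) := by
      filter_upwards [hsupp] with x hx
      have := Real.cos_le_one (1 / n * x)
      have : 0 ≤ (1 - Real.cos (1 / n * x)) / x := div_nonneg (by linarith) hx
      positivity
    calc ∫ x in Set.Iic (n : ℝ), x ∂μ
        ≤ ∫ x in Set.Iic (n : ℝ),
            Real.pi ^ 2 / 2 * n ^ 2 * ((1 - Real.cos (1 / n * x)) / x) ∂μ := by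
          refine integral_mono_of_nonneg (ae_restrict_of_ae hsupp) hG.integrableOn ?_
          rw [EventuallyLE, ae_restrict_iff' measurableSet_Iic]
          filter_upwards [hsupp] with x hx hxn
          rcases hx.eq_or_lt with rfl | hx0
          · simp
          have hxn' : 1 / n * x ≤ 1 := by
            rw [one_div, inv_mul_le_iff₀ hnpos, mul_one]; exact hxn
          have hcos := Real.cos_le_one_sub_mul_cos_sq (x := 1 / n * x) (by
            rw [abs_of_nonneg (by positivity)]
            linarith [Real.pi_gt_three])
          calc x = Real.pi ^ 2 / 2 * n ^ 2 * ((2 / Real.pi ^ 2 * (1 / n * x) ^ 2) / x) := by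
                field_simp [Real.pi_ne_zero]
            _ ≤ _ := by
                gcongr
                linarith
      _ ≤ ∫ x, Real.pi ^ 2 / 2 * n ^ 2 * ((1 - Real.cos (1 / n * x)) / x) ∂μ :=
          setIntegral_le_integral hG hGnonneg
      _ ≤ Real.pi ^ 2 / 2 * n ^ 2 * (C * ((1 / n) ^ 2 / 2)) := by
          rw [integral_const_mul]
          gcongr
          exact hbound _ hh
      _ = Real.pi ^ 2 / 4 * C := by
          field_simp
          ring

theorem hasDerivAt_charFun_zero {μ : Measure ℝ} [IsProbabilityMeasure μ]
    (hint : Integrable (fun x : ℝ => x) μ) :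
    HasDerivAt (charFun μ) (Complex.I * (∫ x, x ∂μ : ℝ)) 0 := by
  have hmem : MemLp id ((1 : ℕ) : ENNReal) μ := by
    rw [Nat.cast_one]; exact memLp_one_iff_integrable.2 hint
  have hdiff : DifferentiableAt ℝ (charFun μ) 0 :=
    (contDiff_charFun hmem).differentiable (by simp) 0
  have hderiv := iteratedDeriv_charFun_zero hmem
  rw [iteratedDeriv_one] at hderiv
  simpa [hderiv, integral_complex_ofReal] using hdiff.hasDerivAt

theorem hasDerivAt_exp_neg_I_mul_zero (c : ℝ) :
    HasDerivAt (fun s : ℝ => Complex.exp (-(Complex.I * s * c))) (-(Complex.I * c)) 0 := by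
  have hlin : HasDerivAt (fun s : ℝ => -(Complex.I * s * c)) (-(Complex.I * c)) 0 := by
    simpa using
      (((hasDerivAt_id (0 : ℝ)).ofReal_comp.const_mul Complex.I).mul_const (c : ℂ)).fun_neg
  simpa using hlin.cexp

/-- The weak law of large numbers, in terms of characteristic functions. -/
theorem tendstoUniformlyOn_charFun_rescaled_pow {μ : Measure ℝ} [IsProbabilityMeasure μ]
    (hint : Integrable (fun x : ℝ => x) μ) {T : ℝ} (hT : 0 < T) :
    TendstoUniformlyOn (fun (N : ℕ) (t : ℝ) => charFun μ (-(t / N)) ^ N)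
      (fun t : ℝ => Complex.exp (-(Complex.I * t * (∫ x, x ∂μ : ℝ)))) atTop (Set.Icc (-T) T) := by
  set E : ℝ := ∫ x, x ∂μ with hE
  have hf : HasDerivAt (fun s => charFun μ (-s)) (-(Complex.I * E)) 0 := by
    have := HasDerivAt.scomp_of_eq (0 : ℝ) (hasDerivAt_charFun_zero hint) (hasDerivAt_neg 0)
      neg_zero.symm
    simpa [Function.comp_def] using this
  refine tendstoUniformlyOn_rescaled_pow (fun s => norm_charFun_le_one _)
    (g := fun s : ℝ => Complex.exp (-(Complex.I * s * E))) (fun s => ?_) ?_ (fun N t hN => ?_) hT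
  · simp [Complex.norm_exp]
  · simpa using (hf.sub (hasDerivAt_exp_neg_I_mul_zero E)).isLittleO
  · have : (N : ℂ) ≠ 0 := by exact_mod_cast hN
    rw [← Complex.exp_nat_mul]
    congr 1
    push_cast
    field_simp

theorem im_charFun_eq_integral_sin {μ : Measure ℝ} [IsProbabilityMeasure μ] (s : ℝ) :
    (charFun μ s).im = ∫ x, Real.sin (s * x) ∂μ := by
  have hint : Integrable (fun x : ℝ => Complex.exp (s * x * Complex.I)) μ :=
    Integrable.of_bound (C := 1) (Continuous.aestronglyMeasurable (by fun_prop))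
      (ae_of_all _ fun x => by simp [Complex.norm_exp])
  rw [charFun_apply_real, ← RCLike.im_eq_complex_im, ← integral_im hint]
  congr with x
  rw [RCLike.im_eq_complex_im, ← Complex.ofReal_mul, Complex.exp_ofReal_mul_I_im]

/-- The converse law of large numbers for characteristic functions of nonnegative variables. -/
theorem integrable_id_of_tendstoUniformlyOn_charFun {μ : Measure ℝ} [IsProbabilityMeasure μ]
    (hsupp : ∀ᵐ x ∂μ, 0 ≤ x) {E : ℝ}
    (hlim : TendstoUniformlyOn (fun (N : ℕ) (t : ℝ) => charFun μ (-(t / N)) ^ N)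
      (fun t : ℝ => Complex.exp (-(Complex.I * t * E))) atTop (Set.Icc (-1) 1)) :
    Integrable (fun x : ℝ => x) μ := by
  have hnorm : ∀ (z : ℂ) (t : ℝ), ‖z * Complex.exp (Complex.I * t * E) - 1‖ =
      ‖z - Complex.exp (-(Complex.I * t * E))‖ := by
    intro z t
    have hunit : ‖Complex.exp (Complex.I * t * E)‖ = 1 := by simp [Complex.norm_exp]
    rw [← mul_one ‖z - _‖, ← hunit, ← norm_mul, sub_mul, ← Complex.exp_add]
    simp
  obtain ⟨δ, hδ, hlinear⟩ := exists_norm_sub_one_le_mul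
    (w := fun s : ℝ => charFun μ (-s) * Complex.exp (Complex.I * s * E))
    ((continuous_charFun.comp continuous_neg).mul (by fun_prop)) (by simp) (by
      filter_upwards [Metric.tendstoUniformlyOn_iff.1 hlim (1 / 2) (by norm_num),
        eventually_ne_atTop 0] with N hN hN0 t ht
      have hN0' : (N : ℂ) ≠ 0 := by exact_mod_cast hN0
      have hexp : (N : ℂ) * (Complex.I * (t / N : ℝ) * E) = Complex.I * t * E := by
        push_cast
        field_simp
      rw [mul_pow, ← Complex.exp_nat_mul, hexp, hnorm, ← dist_eq_norm, dist_comm]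
      exact (hN t ⟨by linarith [ht.1], ht.2⟩).le)
  refine integrable_id_of_integral_sin_le hsupp (C := 3 + |E|) hδ fun s hs => ?_
  have hs' := hlinear s hs
  simp only [hnorm] at hs'
  have him := (Complex.abs_im_le_norm _).trans hs'
  have hrot : (Complex.exp (-(Complex.I * s * E))).im = -Real.sin (s * E) := by
    rw [show -(Complex.I * s * E) = ((-(s * E) : ℝ) : ℂ) * Complex.I by push_cast; ring,
      Complex.exp_ofReal_mul_I_im, Real.sin_neg]
  rw [Complex.sub_im, hrot, charFun_neg, Complex.conj_im, im_charFun_eq_integral_sin] at him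
  have hsinE : Real.sin (s * E) ≤ |E| * s := calc
    Real.sin (s * E) ≤ |s * E| := (le_abs_self _).trans Real.abs_sin_le_abs
    _ = |E| * s := by rw [abs_mul, abs_of_pos hs.1, mul_comm]
  linarith [(abs_le.1 him).1]

/-- A real frequency is determined by its character. -/
theorem eq_of_forall_exp_eq {a b : ℝ}
    (h : ∀ t : ℝ, Complex.exp (-(Complex.I * t * a)) = Complex.exp (-(Complex.I * t * b))) :
    a = b := by
  have hb := hasDerivAt_exp_neg_I_mul_zero b
  rw [← funext h] at hb
  simpa using (hasDerivAt_exp_neg_I_mul_zero a).unique hb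

theorem stmt_11 (μ : Measure ℝ) [IsProbabilityMeasure μ]
    (hsupp : μ (Set.Iio 0) = 0)
    (A : ℝ → ℂ) (hA : ∀ s : ℝ, A s = ∫ l : ℝ, Complex.exp (-(Complex.I * s * l)) ∂μ) :
    (Integrable (fun l : ℝ => l) μ ↔
      ∃ E : ℝ, ∀ T > (0 : ℝ), TendstoUniformlyOn (fun (N : ℕ) (t : ℝ) => A (t / N) ^ N)
        (fun t : ℝ => Complex.exp (-(Complex.I * t * E))) atTop (Set.Icc (-T) T)) ∧
    (∀ E : ℝ, (∀ T > (0 : ℝ), TendstoUniformlyOn (fun (N : ℕ) (t : ℝ) => A (t / N) ^ N)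
        (fun t : ℝ => Complex.exp (-(Complex.I * t * E))) atTop (Set.Icc (-T) T)) →
      E = ∫ l : ℝ, l ∂μ) := by
  have hnonneg : ∀ᵐ x ∂μ, 0 ≤ x := by
    rw [ae_iff]
    simpa only [not_le, Set.Iio_def] using hsupp
  obtain rfl : A = fun s => charFun μ (-s) := by
    funext s
    rw [hA, charFun_apply_real]
    congr with x
    congr 1
    push_cast
    ring
  refine ⟨⟨fun hint => ⟨∫ x, x ∂μ, fun T hT => tendstoUniformlyOn_charFun_rescaled_pow hint hT⟩,
    fun ⟨E, hE⟩ => integrable_id_of_tendstoUniformlyOn_charFun hnonneg (hE 1 one_pos)⟩,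
    fun E hE => eq_of_forall_exp_eq fun t => ?_⟩
  have hint := integrable_id_of_tendstoUniformlyOn_charFun hnonneg (hE 1 one_pos)
  have hT : 0 < |t| + 1 := by positivity
  have ht : t ∈ Set.Icc (-(|t| + 1)) (|t| + 1) := abs_le.1 (by linarith)
  exact tendsto_nhds_unique ((hE _ hT).tendsto_at ht)
    ((tendstoUniformlyOn_charFun_rescaled_pow hint hT).tendsto_at ht)
end
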